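/- (Theorem 4.) Let Φ be a CPTP and population-preserving map on complex square matrices indexed by Fin d_A × Fin d_B (with d_A, d_B ≥ 1). Then Φ fails to be a separable operation if and only if Φ is entangling, i.e. there exists a separable density matrix ρ such that Φ(ρ) is not separable. -/

import Mathlib

open Matrix BigOperators Kronecker
open scoped ComplexOrder

/-- A matrix indexed by `Fin dA × Fin dB` is separable if it is a finite sum of
Kronecker products of positive semidefinite matrices. -/
def MatrixSeparable {dA dB : ℕ}
    (M : Matrix (Fin dA × Fin dB) (Fin dA × Fin dB) ℂ) : Prop :=
  ∃ (n : ℕ) (σ : Fin n → Matrix (Fin dA) (Fin dA) ℂ)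
    (τ : Fin n → Matrix (Fin dB) (Fin dB) ℂ),
    (∀ k, (σ k).PosSemidef) ∧ (∀ k, (τ k).PosSemidef) ∧ M = ∑ k, σ k ⊗ₖ τ k

/-- `Φ` is a separable operation: it admits a Kraus representation in which every
Kraus operator is a Kronecker product `A ℓ ⊗ₖ B ℓ`. -/
def IsSeparableOperation {dA dB : ℕ}
    (Φ : Matrix (Fin dA × Fin dB) (Fin dA × Fin dB) ℂ →
         Matrix (Fin dA × Fin dB) (Fin dA × Fin dB) ℂ) : Prop :=
  ∃ (n : ℕ) (A : Fin n → Matrix (Fin dA) (Fin dA) ℂ)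
    (B : Fin n → Matrix (Fin dB) (Fin dB) ℂ),
    (∀ ρ, Φ ρ = ∑ ℓ, (A ℓ ⊗ₖ B ℓ) * ρ * (A ℓ ⊗ₖ B ℓ)ᴴ) ∧
    ∑ ℓ, (A ℓ ⊗ₖ B ℓ)ᴴ * (A ℓ ⊗ₖ B ℓ) = 1

open scoped MatrixOrder Matrix.Norms.L2Operator in
theorem psd_factor {n : ℕ} (S : Matrix (Fin n) (Fin n) ℂ) (h : S.PosSemidef) :
    ∃ B : Matrix (Fin n) (Fin n) ℂ, S = Bᴴ * B :=
  CStarAlgebra.nonneg_iff_eq_star_mul_self.mp h.nonneg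

theorem sep_op_of_sep {dA dB : ℕ}
    (Φ : Matrix (Fin dA × Fin dB) (Fin dA × Fin dB) ℂ →
         Matrix (Fin dA × Fin dB) (Fin dA × Fin dB) ℂ)
    (M : Matrix (Fin dA × Fin dB) (Fin dA × Fin dB) ℂ)
    (hΦ : ∀ ρ i j, Φ ρ i j = M i j * ρ i j) (hM : ∀ i, M i i = 1)
    (hs : MatrixSeparable M) : IsSeparableOperation Φ := by
  obtain ⟨n, σ, τ, hσ, hτ, hMe⟩ := hs
  have h1 : ∀ k, ∃ B : Matrix (Fin dA) (Fin dA) ℂ, σ k = Bᴴ * B := fun k =>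
    psd_factor _ (hσ k)
  have h2 : ∀ k, ∃ B : Matrix (Fin dB) (Fin dB) ℂ, τ k = Bᴴ * B := fun k =>
    psd_factor _ (hτ k)
  choose P hP using h1
  choose Q hQ using h2
  let e := (Fintype.equivFin (Fin n × Fin dA × Fin dB)).symm
  let A' : Fin n × Fin dA × Fin dB → Matrix (Fin dA) (Fin dA) ℂ :=
    fun x => diagonal (fun i => star (P x.1 x.2.1 i))
  let B' : Fin n × Fin dA × Fin dB → Matrix (Fin dB) (Fin dB) ℂ :=
    fun x => diagonal (fun i => star (Q x.1 x.2.2 i))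
  have hk : ∀ x, A' x ⊗ₖ B' x =
      diagonal (fun p => star (P x.1 x.2.1 p.1) * star (Q x.1 x.2.2 p.2)) := by
    intro x
    exact diagonal_kronecker_diagonal _ _
  have hMM : ∀ i j, M i j = ∑ x : Fin n × Fin dA × Fin dB,
      (star (P x.1 x.2.1 i.1) * star (Q x.1 x.2.2 i.2)) *
        (P x.1 x.2.1 j.1 * Q x.1 x.2.2 j.2) := by
    intro i j
    rw [hMe, Matrix.sum_apply, Fintype.sum_prod_type]
    refine Finset.sum_congr rfl fun k _ => ?_
    rw [Fintype.sum_prod_type, kroneckerMap_apply, hP, hQ, Matrix.mul_apply, Matrix.mul_apply,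
      Finset.sum_mul_sum]
    refine Finset.sum_congr rfl fun a _ => Finset.sum_congr rfl fun b _ => ?_
    simp only [conjTranspose_apply]
    ring
  refine ⟨_, fun l => A' (e l), fun l => B' (e l), ?_, ?_⟩
  · intro ρ
    rw [Equiv.sum_comp e (fun x => (A' x ⊗ₖ B' x) * ρ * (A' x ⊗ₖ B' x)ᴴ)]
    ext i j
    rw [hΦ, hMM, Matrix.sum_apply, Finset.sum_mul]
    refine Finset.sum_congr rfl fun x _ => ?_
    rw [hk, diagonal_conjTranspose, mul_diagonal, diagonal_mul]
    simp only [Pi.star_apply, star_mul', star_star]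
    ring
  · rw [Equiv.sum_comp e (fun x => (A' x ⊗ₖ B' x)ᴴ * (A' x ⊗ₖ B' x))]
    ext i j
    rw [Matrix.sum_apply]
    by_cases hij : i = j
    · subst hij
      rw [one_apply_eq, ← hM i, hMM]
      refine Finset.sum_congr rfl fun x _ => ?_
      rw [hk, diagonal_conjTranspose, diagonal_mul_diagonal, diagonal_apply_eq]
      simp only [Pi.star_apply, star_mul', star_star]
      ring
    · rw [one_apply_ne hij]
      refine Finset.sum_eq_zero fun x _ => ?_
      rw [hk, diagonal_conjTranspose, diagonal_mul_diagonal, diagonal_apply_ne _ hij]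

theorem sep_of_sep_op {dA dB : ℕ}
    (Φ : Matrix (Fin dA × Fin dB) (Fin dA × Fin dB) ℂ →
         Matrix (Fin dA × Fin dB) (Fin dA × Fin dB) ℂ)
    (h : IsSeparableOperation Φ) (ρ : Matrix (Fin dA × Fin dB) (Fin dA × Fin dB) ℂ)
    (hs : MatrixSeparable ρ) : MatrixSeparable (Φ ρ) := by
  obtain ⟨n, σ, τ, hσ, hτ, rfl⟩ := hs
  obtain ⟨m, A, B, hAB, -⟩ := h
  let e := (Fintype.equivFin (Fin m × Fin n)).symm
  refine ⟨_, fun l => A (e l).1 * σ (e l).2 * (A (e l).1)ᴴ,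
    fun l => B (e l).1 * τ (e l).2 * (B (e l).1)ᴴ,
    fun l => (hσ _).mul_mul_conjTranspose_same _,
    fun l => (hτ _).mul_mul_conjTranspose_same _, ?_⟩
  rw [Equiv.sum_comp e (fun x => (A x.1 * σ x.2 * (A x.1)ᴴ) ⊗ₖ (B x.1 * τ x.2 * (B x.1)ᴴ)),
    hAB, Fintype.sum_prod_type]
  refine Finset.sum_congr rfl fun l _ => ?_
  rw [Finset.mul_sum, Finset.sum_mul]
  refine Finset.sum_congr rfl fun k _ => ?_
  rw [conjTranspose_kronecker, mul_kronecker_mul, mul_kronecker_mul]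

theorem const_psd (n : ℕ) (c : ℝ) (hc : 0 ≤ c) :
    (Matrix.of fun _ _ : Fin n => (c : ℂ)).PosSemidef := by
  have h := (posSemidef_vecMulVec_self_star (fun _ : Fin n => ((Real.sqrt c : ℝ) : ℂ)))
  convert h using 1
  ext i j
  simp only [of_apply, vecMulVec_apply, Pi.star_apply, Complex.star_def, Complex.conj_ofReal]
  rw [← Complex.ofReal_mul, Real.mul_self_sqrt hc]

/-- Theorem 4: A CPTP, population-preserving map `Φ` fails to be a
separable operation if and only if it is entangling, i.e. it maps some separable
density matrix to a non-separable matrix. -/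
theorem inseparable_iff_entangling
    (dA dB : ℕ) (hdA : 1 ≤ dA) (hdB : 1 ≤ dB)
    (Φ : Matrix (Fin dA × Fin dB) (Fin dA × Fin dB) ℂ →
         Matrix (Fin dA × Fin dB) (Fin dA × Fin dB) ℂ)
    (hCPTP : ∃ (n : ℕ) (K : Fin n → Matrix (Fin dA × Fin dB) (Fin dA × Fin dB) ℂ),
        (∀ ρ, Φ ρ = ∑ ℓ, K ℓ * ρ * (K ℓ)ᴴ) ∧ ∑ ℓ, (K ℓ)ᴴ * K ℓ = 1)
    (hPP : ∀ ρ : Matrix (Fin dA × Fin dB) (Fin dA × Fin dB) ℂ,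
        ρ.PosSemidef → ρ.trace = 1 → ∀ i, (Φ ρ) i i = ρ i i) :
    ¬ IsSeparableOperation Φ ↔
      ∃ ρ : Matrix (Fin dA × Fin dB) (Fin dA × Fin dB) ℂ,
        ρ.PosSemidef ∧ ρ.trace = 1 ∧ MatrixSeparable ρ ∧ ¬ MatrixSeparable (Φ ρ) := by
  constructor
  · intro hns
    by_contra hne
    push Not at hne
    apply hns
    obtain ⟨n, K, hK, hK1⟩ := hCPTP
    have hdiag : ∀ l i j, j ≠ i → K l j i = 0 := by
      intro l i j hji
      have h := hPP (Matrix.single i i 1) (by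
        rw [← diagonal_single]
        refine PosSemidef.diagonal ?_
        intro k
        by_cases hk : k = i
        · subst hk; simp
        · simp [hk]) (by simp) j
      rw [hK, Matrix.sum_apply, Matrix.single_apply_of_ne (h := by simp [hji.symm])] at h
      have h2 : ∀ l, (K l * (Matrix.single i i 1 : Matrix (Fin dA × Fin dB) (Fin dA × Fin dB) ℂ) * (K l)ᴴ) j j
          = ((Complex.normSq (K l j i) : ℝ) : ℂ) := by
        intro l
        rw [Complex.normSq_eq_conj_mul_self, Matrix.mul_apply, Finset.sum_eq_single i]
        · simp [mul_comm]
        · intro b _ hb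
          simp [hb]
        · simp
      simp only [h2] at h
      rw [← Complex.ofReal_sum, Complex.ofReal_eq_zero,
        Finset.sum_eq_zero_iff_of_nonneg (fun _ _ => Complex.normSq_nonneg _)] at h
      exact Complex.normSq_eq_zero.mp (h l (Finset.mem_univ l))
    have hKd : ∀ l, K l = diagonal (fun i => K l i i) := by
      intro l
      ext i j
      by_cases hij : i = j
      · subst hij; simp
      · rw [diagonal_apply_ne _ hij, hdiag l j i hij]
    let M : Matrix (Fin dA × Fin dB) (Fin dA × Fin dB) ℂ :=
      Matrix.of fun i j => ∑ l, K l i i * star (K l j j)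
    have hMd : ∀ i j, M i j = ∑ l, K l i i * star (K l j j) := fun _ _ => rfl
    have hΦ : ∀ ρ i j, Φ ρ i j = M i j * ρ i j := by
      intro ρ i j
      rw [hK, Matrix.sum_apply, hMd, Finset.sum_mul]
      refine Finset.sum_congr rfl fun l _ => ?_
      rw [hKd l, diagonal_conjTranspose, mul_diagonal, diagonal_mul]
      simp only [Pi.star_apply, diagonal_apply_eq]
      ring
    have hM : ∀ i, M i i = 1 := by
      intro i
      have h := congrFun (congrFun hK1 i) i
      rw [Matrix.sum_apply, one_apply_eq] at h
      rw [← h, hMd]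
      refine Finset.sum_congr rfl fun l _ => ?_
      rw [hKd l, diagonal_conjTranspose, diagonal_mul_diagonal, diagonal_apply_eq]
      simp only [Pi.star_apply, diagonal_apply_eq]
      ring
    have hA : (dA : ℂ) ≠ 0 := by exact_mod_cast (by omega : dA ≠ 0)
    have hB : (dB : ℂ) ≠ 0 := by exact_mod_cast (by omega : dB ≠ 0)
    have hpA := const_psd dA ((dA : ℝ)⁻¹) (by positivity)
    have hpB := const_psd dB ((dB : ℝ)⁻¹) (by positivity)
    obtain ⟨m, σ, τ, hσ, hτ, he⟩ := hne _ (hpA.kronecker hpB) (by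
      rw [trace_kronecker]
      simp [Matrix.trace, hA, hB]) ⟨1, fun _ => _, fun _ => _, fun _ => hpA, fun _ => hpB, by simp⟩
    refine sep_op_of_sep Φ M hΦ hM ⟨m, fun k => ((dA * dB : ℝ) : ℂ) • σ k, τ, fun k => (hσ k).smul ?_, hτ, ?_⟩
    · rw [Complex.zero_le_real]; positivity
    · simp only [smul_kronecker]
      rw [← Finset.smul_sum, ← he]
      ext i j
      rw [Matrix.smul_apply, hΦ, kroneckerMap_apply, of_apply, of_apply]
      push_cast
      rw [smul_eq_mul]
      field_simp
  · rintro ⟨ρ, -, -, hs, hns⟩ h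
    exact hns (sep_of_sep_op Φ h ρ hs)
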